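/- arXiv:math/0306248 — 3 statements merged into one kernel-verified Lean document; each statement's English description precedes it below -/
import Mathlib

section
/- Let β ∈ (0, 1/2^{|S|}), a > 0 and ε ∈ (0, (1/2)·(a/L)^{|S|}·β(1−β)/(L·|S|⁴)). Let q be an irreducible transition matrix on S with stationary distribution μ, satisfying the mixing hypothesis with parameter a on S₁. Let q̂ be a transition matrix that is (ε,β)-close to q on S₁ and coincides with q on S\S₁. Let R be a recurrent class for q̂ containing S₁, and μ̂ the unique stationary distribution of q̂ supported on R. Then for every s ∈ S₁, |1 − (μ̂_s/μ̂_{S₁})/(μ_s/μ_{S₁})| ≤ 18βL, where μ_{S₁} = Σ_{t∈S₁} μ_t and μ̂_{S₁} = Σ_{t∈S₁} μ̂_t. -/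
open Finset

namespace PerturbedMC

variable {S : Type*} [Fintype S] [DecidableEq S]

/-- `q` is a (row-stochastic) transition matrix on `S`: `q s t` is the probability of moving
from `s` to `t`. -/
def IsTransition (q : Matrix S S ℝ) : Prop :=
  (∀ s t, 0 ≤ q s t) ∧ ∀ s, ∑ t, q s t = 1

/-- `q` is irreducible. -/
def IsIrreducible (q : Matrix S S ℝ) : Prop :=
  ∀ s t, ∃ n : ℕ, 1 ≤ n ∧ 0 < (q ^ n) s t

/-- `μ` is a stationary distribution of `q`. -/
def IsStationary (q : Matrix S S ℝ) (μ : S → ℝ) : Prop :=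
  (∀ s, 0 ≤ μ s) ∧ (∑ s, μ s = 1) ∧ ∀ t, ∑ s, μ s * q s t = μ t

/-- The combinatorial constant `L = ∑_{n=1}^{|S|-1} C(|S|,n) · n^{|S|}`. -/
def Lconst (S : Type*) [Fintype S] : ℕ :=
  ∑ n ∈ Finset.Ico 1 (Fintype.card S), (Fintype.card S).choose n * n ^ Fintype.card S

/-- `ζ_q`: the minimal stationary outflow over nonempty proper subsets of `S`. -/
noncomputable def zeta (q : Matrix S S ℝ) (μ : S → ℝ) : ℝ :=
  sInf {x : ℝ | ∃ C : Finset S, C.Nonempty ∧ C ≠ Finset.univ ∧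
    x = ∑ s ∈ C, μ s * ∑ t ∈ Cᶜ, q s t}

/-- `ζ_q^1`: the minimal stationary outflow over nonempty proper subsets of `S₁`. -/
noncomputable def zeta1 (q : Matrix S S ℝ) (μ : S → ℝ) (S1 : Finset S) : ℝ :=
  sInf {x : ℝ | ∃ C : Finset S, C.Nonempty ∧ C ⊂ S1 ∧
    x = ∑ s ∈ C, μ s * ∑ t ∈ Cᶜ, q s t}

/-- `q̂` is `(ε,β)`-close to `q`, relative to the threshold `z` (`z = ζ_q` or `z = ζ_q^1`):
`|q̂(t|s) − q(t|s)| ≤ β·q(t|s)` whenever `μ_s q(t|s) ≥ ε·z` or `μ_s q̂(t|s) ≥ ε·z`. -/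
def IsClose (q qh : Matrix S S ℝ) (μ : S → ℝ) (z ε β : ℝ) : Prop :=
  ∀ s t, (ε * z ≤ μ s * q s t ∨ ε * z ≤ μ s * qh s t) → |qh s t - q s t| ≤ β * q s t

/-- The substochastic `C × C` restriction `q_C` of `q`. -/
def subMat (q : Matrix S S ℝ) (C : Finset S) : Matrix S S ℝ :=
  fun u v => if u ∈ C ∧ v ∈ C then q u v else 0

/-- The exit distribution `Q_{s,q}(t|C) = Σ_{n≥0} Σ_{u∈C} (q_C^n)(u|s)·q(t|u)`. -/
noncomputable def exitProb (q : Matrix S S ℝ) (C : Finset S) (s t : S) : ℝ :=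
  ∑' n : ℕ, ∑ u ∈ C, ((subMat q C ^ n : Matrix S S ℝ) s u) * q u t

/-- The expected exit time `E_{s,q}[T_{C̄}] = Σ_{n≥0} Σ_{u∈C} (q_C^n)(u|s) ∈ [0,∞]`. -/
noncomputable def expExit (q : Matrix S S ℝ) (C : Finset S) (s : S) : ENNReal :=
  ∑' n : ℕ, ENNReal.ofReal (∑ u ∈ C, (subMat q C ^ n : Matrix S S ℝ) s u)

/-- `g` has a cycle within `C`. -/
def HasCycle (C : Finset S) (g : S → S) : Prop :=
  ∃ (k : ℕ) (f : ℕ → S), 0 < k ∧ f k = f 0 ∧ (∀ i < k, f i ∈ C) ∧ ∀ i < k, g (f i) = f (i + 1)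

/-- `g` is a `C`-graph (the values of `g` outside `C` are irrelevant). -/
def IsCGraph (C : Finset S) (g : S → S) : Prop := ¬ HasCycle C g

/-- `s` leads to `t` along `g`: `t` is the first state outside `C` on the `g`-orbit of `s`. -/
def LeadsTo (C : Finset S) (g : S → S) (s t : S) : Prop :=
  ∃ n : ℕ, g^[n] s = t ∧ t ∉ C ∧ ∀ m < n, g^[m] s ∈ C

/-- The weight `p(g) = Π_{s∈C} q(g(s)|s)` of a `C`-graph under `q`. -/
def wt (q : Matrix S S ℝ) (C : Finset S) (g : S → S) : ℝ := ∏ s ∈ C, q s (g s)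

/-- `G(C)`: the canonical representatives of `C`-graphs, namely the maps `S → S` that are
`C`-graphs and are the identity outside `C`. -/
noncomputable def Gset (C : Finset S) : Finset (S → S) :=
  @Finset.filter _ (fun g => IsCGraph C g ∧ ∀ s ∉ C, g s = s) (Classical.decPred _) Finset.univ

/-- `G_{s,t}(C)`: the `C`-graphs along which `s` leads to `t`. -/
noncomputable def GsetLead (C : Finset S) (s t : S) : Finset (S → S) :=
  @Finset.filter _ (fun g => LeadsTo C g s t) (Classical.decPred _) (Gset C)

/-- `g` is an `η`-maximal `C`-graph under `q`: `p(g) ≥ η · max_{g' ∈ G(C)} p(g')`. -/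
def IsMaximal (q : Matrix S S ℝ) (C : Finset S) (η : ℝ) (g : S → S) : Prop :=
  IsCGraph C g ∧ ∀ g', IsCGraph C g' → η * wt q C g' ≤ wt q C g

/-- `H = G^β(C) ∪ Ĝ^β(C)` as a finset of canonical representatives. -/
noncomputable def Hset (q qh : Matrix S S ℝ) (C : Finset S) (β : ℝ) : Finset (S → S) :=
  @Finset.filter _ (fun g => IsMaximal q C β g ∨ IsMaximal qh C β g)
    (Classical.decPred _) (Gset C)

/-- The mixing hypothesis with parameter `a` on `S₁`: for all `s,t ∈ S₁`, the probability
that the chain started at `s`, from its first step onward, reaches `t` before reaching any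
state of `S \ S₁`, is at least `a`. -/
def Mixing (q : Matrix S S ℝ) (S1 : Finset S) (a : ℝ) : Prop :=
  ∀ s ∈ S1, ∀ t ∈ S1,
    a ≤ q s t + ∑ u ∈ S1.erase t, q s u * exitProb q (S1.erase t) u t

/-- `R` is a recurrent class for `q`. -/
def IsRecClass (q : Matrix S S ℝ) (R : Finset S) : Prop :=
  (∀ s ∈ R, ∑ t ∈ Rᶜ, q s t = 0) ∧
    ∀ s ∈ R, ∀ t ∈ R, ∃ n : ℕ, 1 ≤ n ∧ 0 < (q ^ n) s t

set_option linter.unusedSectionVars false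

lemma IsTransition.pow_nonneg {q : Matrix S S ℝ} (hq : ∀ s t, 0 ≤ q s t) (n : ℕ) (s t : S) :
    0 ≤ (q ^ n) s t := by
  induction n generalizing s t with
  | zero =>
    rw [pow_zero, Matrix.one_apply]
    split_ifs <;> norm_num
  | succ n ih =>
    rw [pow_succ, Matrix.mul_apply]
    exact Finset.sum_nonneg fun u _ => mul_nonneg (ih s u) (hq u t)

lemma IsStationary.sum_mul_pow {q : Matrix S S ℝ} {μ : S → ℝ} (hμ : IsStationary q μ) (n : ℕ)
    (t : S) : ∑ s, μ s * (q ^ n) s t = μ t := by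
  induction n generalizing t with
  | zero => simp [Matrix.one_apply]
  | succ n ih =>
    simp_rw [pow_succ, Matrix.mul_apply, Finset.mul_sum]
    rw [Finset.sum_comm, ← hμ.2.2 t]
    refine Finset.sum_congr rfl fun u _ => ?_
    rw [← ih u, Finset.sum_mul]
    exact Finset.sum_congr rfl fun s _ => by ring

/-- A stationary distribution charges every state that is reachable from a charged state. -/
lemma IsStationary.pos_of_pow_pos {q : Matrix S S ℝ} {μ : S → ℝ} (hq : IsTransition q)
    (hμ : IsStationary q μ) {s t : S} (hs : 0 < μ s) {n : ℕ} (h : 0 < (q ^ n) s t) : 0 < μ t := by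
  rw [← hμ.sum_mul_pow n t]
  exact Finset.sum_pos'
    (fun u _ => mul_nonneg (hμ.1 u) (IsTransition.pow_nonneg hq.1 n u t))
    ⟨s, Finset.mem_univ s, mul_pos hs h⟩

lemma IsStationary.exists_pos {q : Matrix S S ℝ} {μ : S → ℝ} (hμ : IsStationary q μ) :
    ∃ s, 0 < μ s := by
  by_contra! h
  have h1 := hμ.2.1
  have h0 : ∑ s, μ s ≤ 0 := Finset.sum_nonpos fun s _ => h s
  linarith

lemma IsStationary.pos {q : Matrix S S ℝ} {μ : S → ℝ} (hq : IsTransition q)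
    (hirr : IsIrreducible q) (hμ : IsStationary q μ) (t : S) : 0 < μ t := by
  obtain ⟨s, hs⟩ := hμ.exists_pos
  obtain ⟨n, -, hn⟩ := hirr s t
  exact hμ.pos_of_pow_pos hq hs hn

/-- The stationary expectation of a function is invariant under one step of the chain. -/
lemma IsStationary.sum_mul_apply {q : Matrix S S ℝ} {μ : S → ℝ} (hμ : IsStationary q μ)
    (f : S → ℝ) : ∑ s, μ s * ∑ t, q s t * f t = ∑ s, μ s * f s := by
  simp_rw [Finset.mul_sum]
  rw [Finset.sum_comm]
  refine Finset.sum_congr rfl fun t _ => ?_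
  rw [← hμ.2.2 t, Finset.sum_mul]
  exact Finset.sum_congr rfl fun s _ => by ring

/-- An irreducible chain can leave every nonempty proper set in one step. -/
lemma IsIrreducible.exists_exit {q : Matrix S S ℝ} (hq : IsTransition q)
    (hirr : IsIrreducible q) {C : Finset S} {s t : S} (hs : s ∈ C) (ht : t ∉ C) :
    ∃ u ∈ C, ∃ v ∉ C, 0 < q u v := by
  by_contra! h
  have key : ∀ n : ℕ, ∀ v ∉ C, (q ^ n) s v = 0 := by
    intro n
    induction n with
    | zero =>
      intro v hv
      rw [pow_zero, Matrix.one_apply_ne]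
      rintro rfl
      exact hv hs
    | succ n ih =>
      intro v hv
      rw [pow_succ, Matrix.mul_apply]
      refine Finset.sum_eq_zero fun u _ => ?_
      by_cases hu : u ∈ C
      · rw [le_antisymm (h u hu v hv) (hq.1 u v), mul_zero]
      · rw [ih u hu, zero_mul]
  obtain ⟨n, -, hn⟩ := hirr s t
  exact hn.ne' (key n t ht)

/-- Stationary outflow equals stationary inflow. -/
lemma IsStationary.outflow_eq_inflow {q : Matrix S S ℝ} {μ : S → ℝ} (hq : IsTransition q)
    (hμ : IsStationary q μ) (C : Finset S) :
    ∑ s ∈ C, μ s * ∑ t ∈ Cᶜ, q s t = ∑ s ∈ Cᶜ, μ s * ∑ t ∈ C, q s t := by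
  have h := hμ.sum_mul_apply fun t => if t ∈ C then 1 else 0
  simp only [mul_ite, mul_one, mul_zero, Finset.sum_ite_mem, Finset.univ_inter] at h
  rw [← Finset.sum_add_sum_compl C] at h
  have h2 : ∑ s ∈ C, μ s * ∑ t ∈ Cᶜ, q s t + ∑ s ∈ C, μ s * ∑ t ∈ C, q s t = ∑ s ∈ C, μ s := by
    rw [← Finset.sum_add_distrib]
    refine Finset.sum_congr rfl fun s _ => ?_
    rw [← mul_add, Finset.sum_compl_add_sum, hq.2 s, mul_one]
  linarith

/-- Any indicator of `A` on `B` extends to a function that is harmonic off `B`, with values in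
the unit interval. -/
lemma IsTransition.exists_harmonic {q : Matrix S S ℝ} (hq : IsTransition q) (A B : Finset S) :
    ∃ h : S → ℝ, (∀ s, 0 ≤ h s) ∧ (∀ s, h s ≤ 1) ∧
      (∀ s ∈ B, h s = if s ∈ A then 1 else 0) ∧ ∀ s ∉ B, h s = ∑ t, q s t * h t := by
  let Φ : (S → ℝ) → S → ℝ := fun f s =>
    if s ∈ B then (if s ∈ A then 1 else 0) else ∑ t, q s t * f t
  have hΦ : Monotone Φ := by
    intro f g hfg s
    simp only [Φ]
    split_ifs
    · exact le_rfl
    · exact le_rfl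
    · exact Finset.sum_le_sum fun t _ => mul_le_mul_of_nonneg_left (hfg t) (hq.1 s t)
  have hΦ0 : 0 ≤ Φ 0 := by
    intro s
    simp only [Φ, Pi.zero_apply, mul_zero, Finset.sum_const_zero]
    split_ifs <;> norm_num
  have hΦ1 : Φ 1 ≤ 1 := by
    intro s
    simp only [Φ, Pi.one_apply, mul_one, hq.2 s]
    split_ifs <;> norm_num
  have hmono : Monotone fun n => Φ^[n] 0 := hΦ.monotone_iterate_of_le_map hΦ0
  have hle : ∀ n, Φ^[n] 0 ≤ 1 := by
    intro n
    induction n with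
    | zero => exact zero_le_one
    | succ n ih =>
      rw [Function.iterate_succ_apply']
      exact (hΦ ih).trans hΦ1
  have hlim : ∀ s, Filter.Tendsto (fun n => Φ^[n] 0 s) Filter.atTop
      (nhds (⨆ n, Φ^[n] 0 s)) := fun s =>
    tendsto_atTop_ciSup (fun m n hmn => hmono hmn s)
      ⟨1, by rintro _ ⟨n, rfl⟩; exact hle n s⟩
  refine ⟨fun s => ⨆ n, Φ^[n] 0 s, fun s => ?_, fun s => ?_, fun s hs => ?_, fun s hs => ?_⟩
  · exact ge_of_tendsto' (hlim s) fun n => hmono (Nat.zero_le n) s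
  · exact le_of_tendsto' (hlim s) fun n => hle n s
  · refine tendsto_nhds_unique ((Filter.tendsto_add_atTop_iff_nat 1).2 (hlim s)) ?_
    simp only [Function.iterate_succ_apply', Φ, if_pos hs]
    exact tendsto_const_nhds
  · refine tendsto_nhds_unique ((Filter.tendsto_add_atTop_iff_nat 1).2 (hlim s)) ?_
    have : ∀ n, Φ^[n + 1] 0 s = ∑ t, q s t * Φ^[n] 0 t := fun n => by
      rw [Function.iterate_succ_apply']
      exact if_neg hs
    simp only [this]
    exact tendsto_finsetSum _ fun t _ => (hlim t).const_mul _

/-- The exit distribution is dominated by every nonnegative supersolution of its one-step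
equation. -/
lemma exitProb_le {q : Matrix S S ℝ} (hq : ∀ s t, 0 ≤ q s t) {D : Finset S} {t : S} {G : S → ℝ}
    (hG0 : ∀ s, 0 ≤ G s) (hG : ∀ s ∈ D, q s t + ∑ u ∈ D, q s u * G u ≤ G s) {s : S}
    (hs : s ∈ D) : exitProb q D s t ≤ G s := by
  have hM : ∀ u v, 0 ≤ subMat q D u v := by
    intro u v
    unfold subMat
    split_ifs
    exacts [hq u v, le_rfl]
  have hstep : ∀ u ∈ D, ∀ k : ℕ, ∑ v ∈ D, (subMat q D ^ (k + 1)) u v * q v t =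
      ∑ w ∈ D, q u w * ∑ v ∈ D, (subMat q D ^ k) w v * q v t := by
    intro u hu k
    simp_rw [pow_succ', Matrix.mul_apply, Finset.sum_mul, Finset.mul_sum]
    rw [Finset.sum_comm, ← Finset.sum_subset (Finset.subset_univ D)]
    · refine Finset.sum_congr rfl fun w hw => Finset.sum_congr rfl fun v _ => ?_
      rw [subMat, if_pos ⟨hu, hw⟩, mul_assoc]
    · intro w _ hw
      refine Finset.sum_eq_zero fun v _ => ?_
      rw [subMat, if_neg fun h => hw h.2, zero_mul, zero_mul]
  have hpart : ∀ n : ℕ, ∀ u ∈ D,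
      ∑ k ∈ Finset.range n, ∑ v ∈ D, (subMat q D ^ k) u v * q v t ≤ G u := by
    intro n
    induction n with
    | zero => intro u _; simpa using hG0 u
    | succ n ih =>
      intro u hu
      rw [Finset.sum_range_succ', Finset.sum_congr rfl fun k _ => hstep u hu k, Finset.sum_comm]
      have h0 : ∑ v ∈ D, (subMat q D ^ 0) u v * q v t = q u t := by
        simp [Matrix.one_apply, hu]
      rw [h0, add_comm]
      refine le_trans (add_le_add_right (Finset.sum_le_sum fun w hw => ?_) _) (hG u hu)
      rw [← Finset.mul_sum]
      exact mul_le_mul_of_nonneg_left (ih w hw) (hq u w)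
  exact Real.tsum_le_of_sum_range_le
    (fun k => Finset.sum_nonneg fun v _ =>
      mul_nonneg (IsTransition.pow_nonneg hM k s v) (hq v t))
    fun n => hpart n s hs

/-- Under mixing, from every state of `C ⊂ S₁` the chain exits `C` into `S₁ \ C` with probability
at least `a`. -/
lemma Mixing.exists_exit_function {q : Matrix S S ℝ} {S1 C : Finset S} {a : ℝ}
    (hq : IsTransition q) (hmix : Mixing q S1 a) (hC : C ⊂ S1) :
    ∃ g : S → ℝ, (∀ s, g s ≤ 1) ∧ (∀ s ∈ C, a ≤ g s) ∧
      ∀ s ∈ C, g s = ∑ t ∈ S1 \ C, q s t + ∑ t ∈ C, q s t * g t := by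
  obtain ⟨g, hg0, hg1, hgB, hgh⟩ := hq.exists_harmonic S1 Cᶜ
  have hone : ∀ u ∈ S1, u ∉ C → g u = 1 := fun u hu huC => by
    rw [hgB u (Finset.mem_compl.2 huC), if_pos hu]
  have hzero : ∀ u ∉ S1, g u = 0 := fun u hu => by
    rw [hgB u (Finset.mem_compl.2 fun h => hu (hC.subset h)), if_neg hu]
  have hS1sum : ∀ s, ∑ t, q s t * g t = ∑ t ∈ S1, q s t * g t := fun s =>
    (Finset.sum_subset (Finset.subset_univ S1) fun u _ hu => by rw [hzero u hu, mul_zero]).symm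
  obtain ⟨t, htS, htC⟩ := Finset.exists_of_ssubset hC
  have herase : ∀ s, q s t + ∑ u ∈ S1.erase t, q s u * g u = ∑ u, q s u * g u := fun s => by
    rw [hS1sum, ← Finset.add_sum_erase S1 _ htS, hone t htS htC, mul_one]
  refine ⟨g, hg1, fun s hs => ?_, fun s hs => ?_⟩
  · refine (hmix s (hC.subset hs) t htS).trans ?_
    rw [hgh s (by simpa using hs), ← herase s]
    refine add_le_add_right (Finset.sum_le_sum fun u hu => ?_) _
    refine mul_le_mul_of_nonneg_left (exitProb_le hq.1 hg0 (fun v hv => ?_) hu) (hq.1 s u)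
    rw [herase v]
    by_cases hvC : v ∈ C
    · exact (hgh v (by simpa using hvC)).ge
    · rw [hone v (Finset.mem_of_mem_erase hv) hvC, ← hq.2 v]
      exact Finset.sum_le_sum fun w _ => mul_le_of_le_one_right (hq.1 v w) (hg1 w)
  · rw [hgh s (by simpa using hs), hS1sum, ← Finset.sum_sdiff hC.subset]
    congr 1
    refine Finset.sum_congr rfl fun u hu => ?_
    rw [hone u (Finset.mem_sdiff.1 hu).1 (Finset.mem_sdiff.1 hu).2, mul_one]

/-- Under mixing, a fraction at least `a` of the stationary outflow of `C ⊂ S₁` goes directly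
into `S₁`. -/
lemma Mixing.mul_outflow_le {q : Matrix S S ℝ} {μ : S → ℝ} {S1 C : Finset S} {a : ℝ}
    (hq : IsTransition q) (hμ : IsStationary q μ) (hmix : Mixing q S1 a) (hC : C ⊂ S1) :
    a * ∑ s ∈ C, μ s * ∑ t ∈ Cᶜ, q s t ≤ ∑ s ∈ C, μ s * ∑ t ∈ S1 \ C, q s t := by
  obtain ⟨g, -, hga, hg⟩ := hmix.exists_exit_function hq hC
  have h := hμ.sum_mul_apply fun t => if t ∈ C then g t else 0
  simp only [mul_ite, mul_zero, Finset.sum_ite_mem, Finset.univ_inter] at h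
  rw [← Finset.sum_add_sum_compl C, Finset.sum_congr rfl fun s hs => congrArg (μ s * ·) (hg s hs)]
    at h
  simp only [mul_add, Finset.sum_add_distrib] at h
  have hin : a * ∑ s ∈ Cᶜ, μ s * ∑ t ∈ C, q s t ≤ ∑ s ∈ Cᶜ, μ s * ∑ t ∈ C, q s t * g t := by
    rw [Finset.mul_sum]
    refine Finset.sum_le_sum fun s _ => ?_
    rw [mul_left_comm, Finset.mul_sum]
    refine mul_le_mul_of_nonneg_left (Finset.sum_le_sum fun t ht => ?_) (hμ.1 s)
    rw [mul_comm]
    exact mul_le_mul_of_nonneg_left (hga t ht) (hq.1 s t)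
  rw [hμ.outflow_eq_inflow hq]
  linarith

/-- Balance of the flow between `C` and `S₁ \ C` for the chain watched on `S₁`, where `h` is the
probability that the first visit to `S₁` is in `C`. -/
lemma IsStationary.watched_balance {q : Matrix S S ℝ} {μ h : S → ℝ} {S1 C : Finset S}
    (hq : IsTransition q) (hμ : IsStationary q μ) (hC : C ⊆ S1)
    (hB : ∀ s ∈ S1, h s = if s ∈ C then 1 else 0) (hh : ∀ s ∉ S1, h s = ∑ t, q s t * h t) :
    ∑ s ∈ C, μ s * ∑ t, q s t * (1 - h t) = ∑ s ∈ S1 \ C, μ s * ∑ t, q s t * h t := by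
  have e := hμ.sum_mul_apply h
  rw [← Finset.sum_add_sum_compl S1, ← Finset.sum_add_sum_compl S1 fun s => μ s * h s,
    Finset.sum_congr rfl fun s hs => congrArg (μ s * ·) (hh s (Finset.mem_compl.1 hs)),
    add_left_inj, ← Finset.sum_sdiff hC, ← Finset.sum_sdiff hC] at e
  have e0 : ∑ s ∈ S1 \ C, μ s * h s = 0 := Finset.sum_eq_zero fun s hs => by
    rw [hB s (Finset.mem_sdiff.1 hs).1, if_neg (Finset.mem_sdiff.1 hs).2, mul_zero]
  have e1 : ∑ s ∈ C, μ s * ∑ t, q s t * (1 - h t) =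
      ∑ s ∈ C, μ s * h s - ∑ s ∈ C, μ s * ∑ t, q s t * h t := by
    rw [← Finset.sum_sub_distrib]
    refine Finset.sum_congr rfl fun s hs => ?_
    rw [hB s (hC hs), if_pos hs, ← mul_sub]
    simp only [mul_sub, mul_one, Finset.sum_sub_distrib, hq.2 s]
  linarith

lemma IsClose.abs_sub_le {q qh : Matrix S S ℝ} {μ : S → ℝ} {z ε β : ℝ} (hq : IsTransition q)
    (hqh : IsTransition qh) (hμ : ∀ s, 0 ≤ μ s) (hβ : 0 ≤ β) (hz : 0 ≤ ε * z)
    (h : IsClose q qh μ z ε β) (s t : S) :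
    |μ s * qh s t - μ s * q s t| ≤ β * (μ s * q s t) + ε * z := by
  have h1 := mul_nonneg (hμ s) (hq.1 s t)
  have h2 := mul_nonneg (hμ s) (hqh.1 s t)
  by_cases hc : ε * z ≤ μ s * q s t ∨ ε * z ≤ μ s * qh s t
  · rw [← mul_sub, abs_mul, abs_of_nonneg (hμ s)]
    have := mul_le_mul_of_nonneg_left (h s t hc) (hμ s)
    linarith
  · push Not at hc
    have := mul_nonneg hβ h1
    rw [abs_le]
    constructor <;> linarith

/-- Weighted sums over `[0,1]`-valued functions inherit the entrywise bound of closeness. -/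
lemma IsClose.abs_sum_sub_le {q qh : Matrix S S ℝ} {μ f : S → ℝ} {z ε β : ℝ}
    (hq : IsTransition q) (hqh : IsTransition qh) (hμ : ∀ s, 0 ≤ μ s) (hβ : 0 ≤ β)
    (hz : 0 ≤ ε * z) (h : IsClose q qh μ z ε β) (hf0 : ∀ s, 0 ≤ f s) (hf1 : ∀ s, f s ≤ 1)
    (C : Finset S) :
    |∑ s ∈ C, μ s * ∑ t, qh s t * f t - ∑ s ∈ C, μ s * ∑ t, q s t * f t| ≤
      β * ∑ s ∈ C, μ s * ∑ t, q s t * f t + (Fintype.card S : ℝ) ^ 2 * (ε * z) := by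
  have hrow : ∀ s, |μ s * ∑ t, qh s t * f t - μ s * ∑ t, q s t * f t| ≤
      β * (μ s * ∑ t, q s t * f t) + Fintype.card S * (ε * z) := by
    intro s
    have e : (β * (μ s * ∑ t, q s t * f t) + Fintype.card S * (ε * z) : ℝ) =
        ∑ t, (β * (μ s * (q s t * f t)) + ε * z) := by
      rw [Finset.sum_add_distrib, Finset.mul_sum, Finset.mul_sum]
      simp
    rw [e, Finset.mul_sum, Finset.mul_sum, ← Finset.sum_sub_distrib]
    refine (Finset.abs_sum_le_sum_abs _ _).trans (Finset.sum_le_sum fun t _ => ?_)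
    have h1 := mul_le_mul_of_nonneg_right (h.abs_sub_le hq hqh hμ hβ hz s t) (hf0 t)
    rw [← abs_of_nonneg (hf0 t), ← abs_mul, abs_of_nonneg (hf0 t)] at h1
    have h2 := mul_le_of_le_one_right hz (hf1 t)
    calc |μ s * (qh s t * f t) - μ s * (q s t * f t)|
        = |(μ s * qh s t - μ s * q s t) * f t| := by congr 1; ring
      _ ≤ _ := by linarith
  rw [← Finset.sum_sub_distrib]
  refine (Finset.abs_sum_le_sum_abs _ _).trans ((Finset.sum_le_sum fun s _ => hrow s).trans ?_)
  rw [Finset.sum_add_distrib, ← Finset.mul_sum, Finset.sum_const, nsmul_eq_mul]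
  have hcard : (C.card : ℝ) ≤ Fintype.card S := by exact_mod_cast Finset.card_le_univ C
  have h3 := mul_le_mul_of_nonneg_right hcard
    (mul_nonneg (Nat.cast_nonneg (α := ℝ) (Fintype.card S)) hz)
  linarith

lemma zeta1_nonneg {q : Matrix S S ℝ} {μ : S → ℝ} (hq : IsTransition q) (hμ : ∀ s, 0 ≤ μ s)
    (S1 : Finset S) : 0 ≤ zeta1 q μ S1 := by
  refine Real.sInf_nonneg ?_
  rintro _ ⟨C, -, -, rfl⟩
  exact Finset.sum_nonneg fun s _ => mul_nonneg (hμ s) (Finset.sum_nonneg fun t _ => hq.1 s t)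

lemma zeta1_le {q : Matrix S S ℝ} {μ : S → ℝ} (hq : IsTransition q) (hμ : ∀ s, 0 ≤ μ s)
    {S1 C : Finset S} (hne : C.Nonempty) (hC : C ⊂ S1) :
    zeta1 q μ S1 ≤ ∑ s ∈ C, μ s * ∑ t ∈ Cᶜ, q s t := by
  refine csInf_le ⟨0, ?_⟩ ⟨C, hne, hC, rfl⟩
  rintro _ ⟨C, -, -, rfl⟩
  exact Finset.sum_nonneg fun s _ => mul_nonneg (hμ s) (Finset.sum_nonneg fun t _ => hq.1 s t)

/-- If across every cut of `A` the infimum of `x` on one side is at most `r` times its supremum on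
the other side, then any two values of `x` on `A` differ at most by the factor `r ^ (|A| - 1)`. -/
lemma le_pow_mul_of_cut_le {α : Type*} {A : Finset α} {x : α → ℝ} {r : ℝ}
    (hr : 1 ≤ r) (hx : ∀ s ∈ A, 0 ≤ x s)
    (hcut : ∀ C ⊂ A, C.Nonempty → ∀ lo hi : ℝ, 0 ≤ lo → 0 ≤ hi → (∀ s ∈ C, lo ≤ x s) →
      (∀ s ∈ A, s ∉ C → x s ≤ hi) → lo ≤ r * hi) {s t : α} (hs : s ∈ A) (ht : t ∈ A) :
    x s ≤ r ^ (A.card - 1) * x t := by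
  by_contra! hlt
  have hr0 : 0 ≤ r := zero_le_one.trans hr
  have key : ∀ j : ℕ, j ≤ A.card - 1 → {u ∈ A | r ^ j * x t < x u}.card + j + 1 ≤ A.card := by
    intro j
    induction j with
    | zero =>
      intro _
      have : {u ∈ A | r ^ 0 * x t < x u} ⊂ A :=
        Finset.filter_ssubset.2 ⟨t, ht, by simp⟩
      have := Finset.card_lt_card this
      omega
    | succ j ih =>
      intro hj
      have hmem : s ∈ {u ∈ A | r ^ (j + 1) * x t < x u} := by
        refine Finset.mem_filter.2 ⟨hs, lt_of_le_of_lt ?_ hlt⟩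
        exact mul_le_mul_of_nonneg_right (pow_le_pow_right₀ hr hj) (hx t ht)
      have hlt' : {u ∈ A | r ^ (j + 1) * x t < x u}.card < {u ∈ A | r ^ j * x t < x u}.card := by
        refine Finset.card_lt_card (Finset.ssubset_iff_subset_ne.2 ⟨fun u hu => ?_, fun heq => ?_⟩)
        · rw [Finset.mem_filter] at hu ⊢
          exact ⟨hu.1, lt_of_le_of_lt (mul_le_mul_of_nonneg_right
            (pow_le_pow_right₀ hr (Nat.le_succ j)) (hx t ht)) hu.2⟩
        · obtain ⟨m, hm, hmin⟩ := Finset.exists_min_image _ x ⟨s, hmem⟩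
          have hm' := Finset.mem_filter.1 hm
          have hss : {u ∈ A | r ^ (j + 1) * x t < x u} ⊂ A :=
            Finset.filter_ssubset.2 ⟨t, ht, not_lt.2
              (le_mul_of_one_le_left (hx t ht) (one_le_pow₀ hr))⟩
          have := hcut _ hss ⟨s, hmem⟩ (x m) (r ^ j * x t) (hx m hm'.1)
            (mul_nonneg (pow_nonneg hr0 j) (hx t ht)) hmin fun u hu hun => by
              rw [heq, Finset.mem_filter] at hun
              exact not_lt.1 fun h => hun ⟨hu, h⟩
          rw [← mul_assoc, ← pow_succ'] at this
          exact absurd hm'.2 (not_lt.2 this)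
      have := ih (by omega)
      omega
  have hmem : s ∈ {u ∈ A | r ^ (A.card - 1) * x t < x u} := Finset.mem_filter.2 ⟨hs, hlt⟩
  have := key _ le_rfl
  have := Finset.card_pos.2 ⟨s, hmem⟩
  omega

/-- If the values of `x = ν / μ` on `A` differ at most by a factor `ρ`, then so do the normalized
weights. -/
lemma abs_one_sub_div_le {α : Type*} {A : Finset α} {μ ν : α → ℝ} {ρ : ℝ}
    (hμ : ∀ s ∈ A, 0 < μ s) (hν : ∀ s ∈ A, 0 < ν s)
    (h : ∀ s ∈ A, ∀ t ∈ A, ν s / μ s ≤ ρ * (ν t / μ t)) {s : α} (hs : s ∈ A) :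
    |1 - (ν s / ∑ t ∈ A, ν t) / (μ s / ∑ t ∈ A, μ t)| ≤ ρ - 1 := by
  have hP : 0 < ∑ t ∈ A, μ t := Finset.sum_pos hμ ⟨s, hs⟩
  have hN : 0 < ∑ t ∈ A, ν t := Finset.sum_pos hν ⟨s, hs⟩
  have hx : 0 < ν s / μ s := div_pos (hν s hs) (hμ s hs)
  have hρ : 1 ≤ ρ := by
    by_contra! hlt
    have := h s hs s hs
    nlinarith
  have hval : (ν s / ∑ t ∈ A, ν t) / (μ s / ∑ t ∈ A, μ t) =
      ν s / μ s * (∑ t ∈ A, μ t) / ∑ t ∈ A, ν t := by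
    have := (hμ s hs).ne'
    field_simp
  have hup : ν s / μ s * (∑ t ∈ A, μ t) ≤ ρ * ∑ t ∈ A, ν t := by
    rw [Finset.mul_sum, Finset.mul_sum]
    refine Finset.sum_le_sum fun t ht => ?_
    have := mul_le_mul_of_nonneg_right (h s hs t ht) (hμ t ht).le
    rwa [mul_assoc, div_mul_cancel₀ _ (hμ t ht).ne'] at this
  have hlo : ∑ t ∈ A, ν t ≤ ρ * (ν s / μ s * ∑ t ∈ A, μ t) := by
    rw [Finset.mul_sum, Finset.mul_sum]
    refine Finset.sum_le_sum fun t ht => ?_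
    have := mul_le_mul_of_nonneg_right (h t ht s hs) (hμ t ht).le
    rwa [mul_assoc, div_mul_cancel₀ _ (hμ t ht).ne'] at this
  rw [hval, abs_le]
  have hu := (div_le_iff₀ hN).2 hup
  have hl : 1 ≤ ρ * (ν s / μ s * (∑ t ∈ A, μ t) / ∑ t ∈ A, ν t) := by
    rw [← mul_div_assoc, le_div_iff₀ hN, one_mul]
    exact hlo
  constructor
  · linarith
  · nlinarith

lemma one_add_pow_le {x : ℝ} (hx0 : 0 ≤ x) (hx1 : x ≤ 1) (n : ℕ) :
    (1 + x) ^ n ≤ 1 + (2 ^ n - 1) * x := by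
  induction n with
  | zero => simp
  | succ n ih =>
    have h1 : (1 : ℝ) ≤ 2 ^ n := one_le_pow₀ one_le_two
    have h2 := mul_le_mul_of_nonneg_right ih (by linarith : 0 ≤ 1 + x)
    have h3 : (2 ^ n - 1) * x * x ≤ (2 ^ n - 1) * x :=
      mul_le_of_le_one_right (mul_nonneg (by linarith) hx0) hx1
    rw [pow_succ, pow_succ]
    linarith

lemma two_pow_le_Lconst {α : Type*} [Fintype α] (h : 2 ≤ Fintype.card α) :
    2 ^ (Fintype.card α - 1) ≤ Lconst α := by
  have hle : ∑ n ∈ Finset.Ico 1 (Fintype.card α), (Fintype.card α).choose n ≤ Lconst α :=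
    Finset.sum_le_sum fun n hn =>
      Nat.le_mul_of_pos_right _ (Nat.pow_pos (Finset.mem_Ico.1 hn).1)
  have hsum := Nat.sum_range_choose (Fintype.card α)
  rw [Finset.sum_range_succ, Finset.range_eq_Ico, Finset.sum_eq_sum_Ico_succ_bot (by omega),
    Nat.choose_zero_right, Nat.choose_self, zero_add] at hsum
  obtain ⟨k, hk⟩ : ∃ k, Fintype.card α = k + 2 := ⟨_, (Nat.sub_add_cancel h).symm⟩
  rw [hk] at hle hsum ⊢
  have : 2 ^ (k + 2) = 2 * 2 ^ (k + 1) := by ring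
  have : 2 ^ (k + 1) = 2 * 2 ^ k := by ring
  have := Nat.one_le_two_pow (n := k)
  simp only [show k + 2 - 1 = k + 1 by omega]
  omega

/-- Across any cut of `S₁`, the density `μ̂ / μ` cannot drop by more than the factor
`(1 + b) / (1 - b)`. -/
lemma density_cut_le {q qh : Matrix S S ℝ} {μ μh : S → ℝ} {S1 C : Finset S} {β ε a b : ℝ}
    (hβ0 : 0 ≤ β) (hε0 : 0 ≤ ε) (ha : 0 < a) (hb1 : b < 1)
    (hεb : (Fintype.card S : ℝ) ^ 2 * ε ≤ (b - β) * a)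
    (hq : IsTransition q) (hqirr : IsIrreducible q) (hμ : IsStationary q μ)
    (hmix : Mixing q S1 a) (hqh : IsTransition qh)
    (hclose : IsClose q qh μ (zeta1 q μ S1) ε β)
    (hcoin : ∀ s ∉ S1, ∀ t, qh s t = q s t) (hμh : IsStationary qh μh)
    (hC : C ⊂ S1) (hne : C.Nonempty) {lo hi : ℝ} (hlo0 : 0 ≤ lo) (hhi0 : 0 ≤ hi)
    (hlo : ∀ s ∈ C, lo ≤ μh s / μ s) (hhi : ∀ s ∈ S1, s ∉ C → μh s / μ s ≤ hi) :
    lo ≤ (1 + b) / (1 - b) * hi := by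
  have hμpos := hμ.pos hq hqirr
  obtain ⟨h, hh0, hh1, hB, hh⟩ := hq.exists_harmonic C S1
  have hhat : ∀ s ∉ S1, h s = ∑ t, qh s t * h t := fun s hs => by
    rw [hh s hs]
    exact Finset.sum_congr rfl fun t _ => by rw [hcoin s hs t]
  have bal := hμ.watched_balance hq hC.subset hB hh
  have balh := hμh.watched_balance hqh hC.subset hB hhat
  set F := ∑ s ∈ C, μ s * ∑ t, q s t * (1 - h t) with hF
  have hz0 := zeta1_nonneg hq hμ.1 S1
  have hz := mul_nonneg hε0 hz0
  have hout : a * ∑ s ∈ C, μ s * ∑ t ∈ Cᶜ, q s t ≤ F := by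
    refine (hmix.mul_outflow_le hq hμ hC).trans (Finset.sum_le_sum fun s _ => ?_)
    refine mul_le_mul_of_nonneg_left ?_ (hμ.1 s)
    have hval : ∑ t ∈ S1 \ C, q s t = ∑ t ∈ S1 \ C, q s t * (1 - h t) :=
      Finset.sum_congr rfl fun t ht => by
        rw [hB t (Finset.mem_sdiff.1 ht).1, if_neg (Finset.mem_sdiff.1 ht).2, sub_zero, mul_one]
    rw [hval]
    exact Finset.sum_le_sum_of_subset_of_nonneg (Finset.subset_univ _) fun t _ _ =>
      mul_nonneg (hq.1 s t) (sub_nonneg.2 (hh1 t))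
  have houtpos : 0 < ∑ s ∈ C, μ s * ∑ t ∈ Cᶜ, q s t := by
    obtain ⟨s, hs⟩ := hne
    obtain ⟨t, -, ht⟩ := Finset.exists_of_ssubset hC
    obtain ⟨u, hu, v, hv, huv⟩ := hqirr.exists_exit hq hs ht
    refine Finset.sum_pos' (fun s _ => mul_nonneg (hμ.1 s)
      (Finset.sum_nonneg fun t _ => hq.1 s t)) ⟨u, hu, mul_pos (hμpos u) ?_⟩
    exact Finset.sum_pos' (fun t _ => hq.1 u t) ⟨v, Finset.mem_compl.2 hv, huv⟩
  have hFpos : 0 < F := (mul_pos ha houtpos).trans_le hout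
  have hzF : (Fintype.card S : ℝ) ^ 2 * (ε * zeta1 q μ S1) ≤ (b - β) * F := by
    have hba : 0 ≤ (b - β) := by
      have : 0 ≤ (b - β) * a := (by positivity : (0 : ℝ) ≤ Fintype.card S ^ 2 * ε).trans hεb
      exact nonneg_of_mul_nonneg_left this ha
    have h1 := mul_le_mul_of_nonneg_right hεb hz0
    have h2 := mul_le_mul_of_nonneg_left (zeta1_le hq hμ.1 hne hC) ha.le
    have h3 := mul_le_mul_of_nonneg_left (h2.trans hout) hba
    linarith
  have c1 := (abs_le.1 (hclose.abs_sum_sub_le hq hqh hμ.1 hβ0 hz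
    (fun s => sub_nonneg.2 (hh1 s)) (fun s => sub_le_self 1 (hh0 s)) C)).1
  have c2 := (abs_le.1 (hclose.abs_sum_sub_le hq hqh hμ.1 hβ0 hz hh0 hh1 (S1 \ C))).2
  rw [← hF] at c1
  rw [← bal] at c2
  have l1 : lo * ∑ s ∈ C, μ s * ∑ t, qh s t * (1 - h t) ≤
      ∑ s ∈ C, μh s * ∑ t, qh s t * (1 - h t) := by
    rw [Finset.mul_sum]
    refine Finset.sum_le_sum fun s hs => ?_
    rw [← mul_assoc]
    exact mul_le_mul_of_nonneg_right ((le_div_iff₀ (hμpos s)).1 (hlo s hs))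
      (Finset.sum_nonneg fun t _ => mul_nonneg (hqh.1 s t) (sub_nonneg.2 (hh1 t)))
  have l2 : ∑ s ∈ S1 \ C, μh s * ∑ t, qh s t * h t ≤
      hi * ∑ s ∈ S1 \ C, μ s * ∑ t, qh s t * h t := by
    rw [Finset.mul_sum]
    refine Finset.sum_le_sum fun s hs => ?_
    rw [← mul_assoc]
    exact mul_le_mul_of_nonneg_right
      ((div_le_iff₀ (hμpos s)).1 (hhi s (Finset.mem_sdiff.1 hs).1 (Finset.mem_sdiff.1 hs).2))
      (Finset.sum_nonneg fun t _ => mul_nonneg (hqh.1 s t) (hh0 t))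
  have m1 : lo * ((1 - b) * F) ≤ lo * ∑ s ∈ C, μ s * ∑ t, qh s t * (1 - h t) :=
    mul_le_mul_of_nonneg_left (by linarith) hlo0
  have m2 : hi * ∑ s ∈ S1 \ C, μ s * ∑ t, qh s t * h t ≤ hi * ((1 + b) * F) :=
    mul_le_mul_of_nonneg_left (by linarith) hhi0
  rw [div_mul_eq_mul_div, le_div_iff₀ (by linarith)]
  refine le_of_mul_le_mul_right ?_ hFpos
  linarith

/-- the conditional stationary distributions on `S₁` are close:
`|1 − (μ̂_s/μ̂_{S₁})/(μ_s/μ_{S₁})| ≤ 18βL` for every `s ∈ S₁`. -/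
theorem perturbed_conditional_stationary_close
    (hcard : 2 ≤ Fintype.card S)
    (q qh : Matrix S S ℝ) (μ : S → ℝ) (S1 : Finset S) (hS1 : 1 < S1.card)
    (β ε a : ℝ)
    (hβ0 : 0 < β) (hβ1 : β < 1 / 2 ^ Fintype.card S) (ha : 0 < a)
    (hε0 : 0 < ε)
    (hε1 : ε < 1 / 2 * (a / (Lconst S : ℝ)) ^ Fintype.card S *
        (β * (1 - β) / ((Lconst S : ℝ) * (Fintype.card S : ℝ) ^ 4)))
    (hq : IsTransition q) (hqirr : IsIrreducible q) (hμ : IsStationary q μ)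
    (hmix : Mixing q S1 a)
    (hqh : IsTransition qh)
    (hclose : IsClose q qh μ (zeta1 q μ S1) ε β)
    (hcoin : ∀ s ∉ S1, ∀ t, qh s t = q s t)
    (R : Finset S) (hR : IsRecClass qh R) (hS1R : S1 ⊆ R)
    (μh : S → ℝ) (hμh : IsStationary qh μh) (hsupp : ∀ s ∉ R, μh s = 0) :
    ∀ s ∈ S1,
      |1 - (μh s / ∑ t ∈ S1, μh t) / (μ s / ∑ t ∈ S1, μ t)| ≤ 18 * β * (Lconst S : ℝ) := by
  have hN : (2 : ℝ) ≤ Fintype.card S := by exact_mod_cast hcard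
  have hL : (2 : ℝ) ^ (Fintype.card S - 1) ≤ Lconst S := by
    exact_mod_cast two_pow_le_Lconst hcard
  have hL1 : (1 : ℝ) ≤ Lconst S := (one_le_pow₀ one_le_two).trans hL
  have hβ4 : β < 1 / 4 := by
    refine hβ1.trans_le (one_div_le_one_div_of_le (by norm_num) ?_)
    calc (4 : ℝ) = 2 ^ 2 := by norm_num
      _ ≤ 2 ^ Fintype.card S := pow_le_pow_right₀ one_le_two hcard
  have ha1 : a ≤ 1 := by
    obtain ⟨s, hs⟩ := Finset.card_pos.1 (zero_lt_one.trans hS1)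
    have hss : {s} ⊂ S1 := Finset.ssubset_iff_subset_ne.2
      ⟨Finset.singleton_subset_iff.2 hs, by rintro rfl; simp at hS1⟩
    obtain ⟨g, hg1, hga, -⟩ := hmix.exists_exit_function hq hss
    exact (hga s (Finset.mem_singleton_self s)).trans (hg1 s)
  have hεb : (Fintype.card S : ℝ) ^ 2 * ε ≤ (4 / 3 * β - β) * a := by
    have haL : a / Lconst S ≤ a := div_le_self ha.le hL1
    have hpow : (a / Lconst S : ℝ) ^ Fintype.card S ≤ a :=
      (pow_le_of_le_one (by positivity) (haL.trans ha1) (by omega)).trans haL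
    have hfrac : β * (1 - β) / ((Lconst S : ℝ) * (Fintype.card S : ℝ) ^ 4) ≤
        β / (Fintype.card S : ℝ) ^ 4 := by
      gcongr
      · exact mul_le_of_le_one_right hβ0.le (by linarith)
      · exact le_mul_of_one_le_left (by positivity) hL1
    have hε2 : ε ≤ 1 / 2 * a * (β / (Fintype.card S : ℝ) ^ 4) := by
      refine hε1.le.trans (mul_le_mul (by linarith) hfrac ?_ (by positivity))
      exact div_nonneg (mul_nonneg hβ0.le (by linarith)) (by positivity)
    have hN4 : (4 : ℝ) ≤ (Fintype.card S : ℝ) ^ 2 := by nlinarith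
    calc (Fintype.card S : ℝ) ^ 2 * ε
        ≤ (Fintype.card S : ℝ) ^ 2 * (1 / 2 * a * (β / (Fintype.card S : ℝ) ^ 4)) := by gcongr
      _ = 1 / 2 * a * β / (Fintype.card S : ℝ) ^ 2 := by field_simp
      _ ≤ 1 / 2 * a * β / 4 := by gcongr
      _ ≤ (4 / 3 * β - β) * a := by nlinarith [mul_pos ha hβ0]
  set r : ℝ := (1 + 4 / 3 * β) / (1 - 4 / 3 * β) with hr
  have hr1 : 1 ≤ r := by
    rw [hr, le_div_iff₀ (by linarith)]
    linarith
  have hr2 : r ≤ 1 + 4 * β := by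
    rw [hr, div_le_iff₀ (by linarith)]
    nlinarith
  have hμpos := hμ.pos hq hqirr
  have hμhpos : ∀ s ∈ S1, 0 < μh s := by
    intro t ht
    obtain ⟨s, hs⟩ := hμh.exists_pos
    have hsR : s ∈ R := by
      by_contra hn
      exact hs.ne' (hsupp s hn)
    obtain ⟨n, -, hn⟩ := hR.2 s hsR t (hS1R ht)
    exact hμh.pos_of_pow_pos hqh hs hn
  have hratio : ∀ s ∈ S1, ∀ t ∈ S1,
      μh s / μ s ≤ r ^ (S1.card - 1) * (μh t / μ t) := fun s hs t ht =>
    le_pow_mul_of_cut_le hr1 (fun u hu => (div_pos (hμhpos u hu) (hμpos u)).le)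
      (fun C hC hne lo hi hlo0 hhi0 hlo hhi =>
        density_cut_le hβ0.le hε0.le ha (by linarith) hεb hq hqirr hμ hmix hqh hclose hcoin hμh
          hC hne hlo0 hhi0 hlo hhi) hs ht
  have hρ : r ^ (S1.card - 1) - 1 ≤ 18 * β * (Lconst S : ℝ) := by
    have h1 : r ^ (S1.card - 1) ≤ (1 + 4 * β) ^ (Fintype.card S - 1) :=
      (pow_le_pow_left₀ (by linarith) hr2 _).trans
        (pow_le_pow_right₀ (by linarith) (Nat.sub_le_sub_right (Finset.card_le_univ S1) 1))
    have h2 := one_add_pow_le (x := 4 * β) (by linarith) (by linarith) (Fintype.card S - 1)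
    have h3 := mul_le_mul_of_nonneg_right hL hβ0.le
    have h4 := mul_nonneg (zero_le_one.trans hL1) hβ0.le
    linarith
  intro s hs
  exact (abs_one_sub_div_le (fun u _ => hμpos u) hμhpos hratio hs).trans hρ

end PerturbedMC
end

section
/- Let q be a transition matrix on S, η₁, η₂ > 0, and let C₁, C₂ be disjoint nonempty subsets of S with C₁ ∪ C₂ a proper subset of S. Let g_i be an η_i-maximal C_i-graph under q, for i = 1,2. If the map g₁ ∪ g₂ : C₁∪C₂ → S (equal to g_i on C_i) is a (C₁∪C₂)-graph, i.e. has no cycles, then it is η₁η₂-maximal under q. -/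
open Finset

namespace PerturbedMC

variable {S : Type*} [Fintype S] [DecidableEq S]

theorem IsCGraph.mono {C D : Finset S} {g : S → S} (hCD : C ⊆ D) (hg : IsCGraph D g) :
    IsCGraph C g := by
  rintro ⟨k, f, hk, hf, hmem, hstep⟩
  exact hg ⟨k, f, hk, hf, fun i hi => hCD (hmem i hi), hstep⟩

theorem wt_nonneg {q : Matrix S S ℝ} (hq : IsTransition q) (C : Finset S) (g : S → S) :
    0 ≤ wt q C g :=
  Finset.prod_nonneg fun s _ => hq.1 s (g s)

theorem wt_union (q : Matrix S S ℝ) {C D : Finset S} (h : Disjoint C D) (g : S → S) :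
    wt q (C ∪ D) g = wt q C g * wt q D g :=
  Finset.prod_union h

theorem wt_congr (q : Matrix S S ℝ) {C : Finset S} {g g' : S → S} (h : ∀ s ∈ C, g s = g' s) :
    wt q C g = wt q C g' :=
  Finset.prod_congr rfl fun s hs => by rw [h s hs]

/-- property P2: if `gᵢ` is an `ηᵢ`-maximal `Cᵢ`-graph (`i = 1,2`) and the
map `g` equal to `gᵢ` on `Cᵢ` is a `(C₁ ∪ C₂)`-graph, then `g` is `η₁η₂`-maximal. -/
theorem union_maximal
    (hcard : 2 ≤ Fintype.card S)
    (q : Matrix S S ℝ) (hq : IsTransition q)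
    (η1 η2 : ℝ) (hη1 : 0 < η1) (hη2 : 0 < η2)
    (C1 C2 : Finset S) (h1 : C1.Nonempty) (h2 : C2.Nonempty)
    (hdisj : Disjoint C1 C2) (hproper : C1 ∪ C2 ≠ Finset.univ)
    (g1 g2 g : S → S)
    (hg1 : IsMaximal q C1 η1 g1) (hg2 : IsMaximal q C2 η2 g2)
    (hgeq1 : ∀ s ∈ C1, g s = g1 s) (hgeq2 : ∀ s ∈ C2, g s = g2 s)
    (hcg : IsCGraph (C1 ∪ C2) g) :
    IsMaximal q (C1 ∪ C2) (η1 * η2) g := by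
  refine ⟨hcg, fun g' hg' => ?_⟩
  rw [wt_union q hdisj, wt_union q hdisj, wt_congr q hgeq1, wt_congr q hgeq2, mul_mul_mul_comm]
  exact mul_le_mul (hg1.2 g' (hg'.mono subset_union_left))
    (hg2.2 g' (hg'.mono subset_union_right))
    (mul_nonneg hη2.le (wt_nonneg hq C2 g')) (wt_nonneg hq C1 g1)

end PerturbedMC
end

section
/- Let β ∈ (0, 1/2^{|S|}) and ε ∈ (0, β(1−β)/(L·|S|⁴)). Let q be an irreducible transition matrix on S with stationary distribution μ, and let q̂ be a transition matrix that is (ε,β)-close to q. Then for every nonempty proper subset C of S, ((1−β)/|S|²)·Σ_{s∈C} μ_s q(C̄|s) ≤ Σ_{s∈C} μ_s q̂(C̄|s) ≤ (1+β)·|S|²·Σ_{s∈C} μ_s q(C̄|s). -/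
open Finset

namespace PerturbedMC

variable {S : Type*} [Fintype S] [DecidableEq S]

/-- The minimal stationary outflow is at most the outflow of any nonempty proper subset. -/
lemma zeta_le_outflow {q : Matrix S S ℝ} {μ : S → ℝ} (hq : ∀ s t, 0 ≤ q s t)
    (hμ : ∀ s, 0 ≤ μ s) {C : Finset S} (hC : C.Nonempty) (hC' : C ≠ Finset.univ) :
    zeta q μ ≤ ∑ s ∈ C, μ s * ∑ t ∈ Cᶜ, q s t := by
  refine csInf_le ⟨0, ?_⟩ ⟨C, hC, hC', rfl⟩
  rintro x ⟨D, -, -, rfl⟩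
  exact Finset.sum_nonneg fun s _ => mul_nonneg (hμ s) (Finset.sum_nonneg fun t _ => hq s t)

/-- For close matrices, flows along a single edge differ by at most a `β`-fraction of the flow
plus the threshold. -/
lemma IsClose.abs_flow_sub_le {T : Type*} {q qh : Matrix T T ℝ} {μ : T → ℝ} {z ε β : ℝ}
    (h : IsClose q qh μ z ε β) (hβ : 0 ≤ β) (hε : 0 ≤ ε * z) (hμ : ∀ s, 0 ≤ μ s)
    (hq : ∀ s t, 0 ≤ q s t) (hqh : ∀ s t, 0 ≤ qh s t) (s t : T) :
    |μ s * qh s t - μ s * q s t| ≤ β * (μ s * q s t) + ε * z := by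
  have hx := mul_nonneg (hμ s) (hq s t)
  have hy := mul_nonneg (hμ s) (hqh s t)
  have hβx := mul_nonneg hβ hx
  by_cases hst : ε * z ≤ μ s * q s t ∨ ε * z ≤ μ s * qh s t
  · rw [← mul_sub, abs_mul, abs_of_nonneg (hμ s)]
    nlinarith [mul_le_mul_of_nonneg_left (h s t hst) (hμ s)]
  · push Not at hst
    rw [abs_le]
    constructor <;> linarith [hst.1, hst.2]

/-- For close matrices, outflows differ by at most a `β`-fraction of the outflow plus
`|S|²` times the threshold. -/
lemma IsClose.abs_outflow_sub_le {q qh : Matrix S S ℝ} {μ : S → ℝ} {z ε β : ℝ}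
    (h : IsClose q qh μ z ε β) (hβ : 0 ≤ β) (hε : 0 ≤ ε * z) (hμ : ∀ s, 0 ≤ μ s)
    (hq : ∀ s t, 0 ≤ q s t) (hqh : ∀ s t, 0 ≤ qh s t) (C : Finset S) :
    |(∑ s ∈ C, μ s * ∑ t ∈ Cᶜ, qh s t) - ∑ s ∈ C, μ s * ∑ t ∈ Cᶜ, q s t| ≤
      β * (∑ s ∈ C, μ s * ∑ t ∈ Cᶜ, q s t) + (Fintype.card S : ℝ) ^ 2 * (ε * z) := by
  simp only [Finset.mul_sum (s := Cᶜ), ← Finset.sum_product', ← Finset.sum_sub_distrib]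
  calc |∑ p ∈ C ×ˢ Cᶜ, (μ p.1 * qh p.1 p.2 - μ p.1 * q p.1 p.2)|
      ≤ ∑ p ∈ C ×ˢ Cᶜ, |μ p.1 * qh p.1 p.2 - μ p.1 * q p.1 p.2| :=
        Finset.abs_sum_le_sum_abs _ _
    _ ≤ ∑ p ∈ C ×ˢ Cᶜ, (β * (μ p.1 * q p.1 p.2) + ε * z) :=
        Finset.sum_le_sum fun p _ => h.abs_flow_sub_le hβ hε hμ hq hqh p.1 p.2
    _ = β * (∑ p ∈ C ×ˢ Cᶜ, μ p.1 * q p.1 p.2) + ((C ×ˢ Cᶜ).card : ℝ) * (ε * z) := by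
        rw [Finset.sum_add_distrib, ← Finset.mul_sum, Finset.sum_const, nsmul_eq_mul]
    _ ≤ _ := by
        have hcard : ((C ×ˢ Cᶜ).card : ℝ) ≤ (Fintype.card S : ℝ) ^ 2 := by
          rw [Finset.card_product, sq]
          exact_mod_cast Nat.mul_le_mul (Finset.card_le_univ C) (Finset.card_le_univ Cᶜ)
        gcongr

/-- Lemma `basic1`: for every nonempty proper `C ⊂ S`,
`((1−β)/|S|²)·Σ_{s∈C} μ_s q(C̄|s) ≤ Σ_{s∈C} μ_s q̂(C̄|s) ≤ (1+β)|S|²·Σ_{s∈C} μ_s q(C̄|s)`. -/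
theorem perturbed_outflow_close
    (hcard : 2 ≤ Fintype.card S)
    (q qh : Matrix S S ℝ) (μ : S → ℝ) (β ε : ℝ)
    (hβ0 : 0 < β) (hβ1 : β < 1 / 2 ^ Fintype.card S)
    (hε0 : 0 < ε)
    (hε1 : ε < β * (1 - β) / ((Lconst S : ℝ) * (Fintype.card S : ℝ) ^ 4))
    (hq : IsTransition q) (hqirr : IsIrreducible q) (hμ : IsStationary q μ)
    (hqh : IsTransition qh)
    (hclose : IsClose q qh μ (zeta q μ) ε β) :
    ∀ C : Finset S, C.Nonempty → C ≠ Finset.univ →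
      (1 - β) / (Fintype.card S : ℝ) ^ 2 * ∑ s ∈ C, μ s * ∑ t ∈ Cᶜ, q s t ≤
          (∑ s ∈ C, μ s * ∑ t ∈ Cᶜ, qh s t) ∧
        (∑ s ∈ C, μ s * ∑ t ∈ Cᶜ, qh s t) ≤
          (1 + β) * (Fintype.card S : ℝ) ^ 2 * ∑ s ∈ C, μ s * ∑ t ∈ Cᶜ, q s t := by
  intro C hC hC'
  have hζ : 0 ≤ zeta q μ := by
    refine Real.sInf_nonneg ?_
    rintro x ⟨D, -, -, rfl⟩
    exact Finset.sum_nonneg fun s _ =>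
      mul_nonneg (hμ.1 s) (Finset.sum_nonneg fun t _ => hq.1 s t)
  have hζX := zeta_le_outflow hq.1 hμ.1 hC hC'
  have hXY := hclose.abs_outflow_sub_le hβ0.le (mul_nonneg hε0.le hζ) hμ.1 hq.1 hqh.1 C
  set X := ∑ s ∈ C, μ s * ∑ t ∈ Cᶜ, q s t
  set Y := ∑ s ∈ C, μ s * ∑ t ∈ Cᶜ, qh s t
  have hX : 0 ≤ X := hζ.trans hζX
  have hN : (2 : ℝ) ≤ Fintype.card S := by exact_mod_cast hcard
  set N := (Fintype.card S : ℝ)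
  have hN2 : 4 ≤ N ^ 2 := by nlinarith
  have hβ : β < 1 := hβ1.trans_le <| by
    rw [div_le_one (by positivity)]
    exact one_le_pow₀ one_le_two
  have hL : (1 : ℝ) ≤ Lconst S := by
    rcases Nat.eq_zero_or_pos (Lconst S) with h | h
    · rw [h, Nat.cast_zero, zero_mul, div_zero] at hε1
      exact absurd hε1 hε0.not_gt
    · exact_mod_cast h
  have hεN : ε * N ^ 2 ≤ β * (1 - β) / N ^ 2 := by
    rw [lt_div_iff₀ (by positivity)] at hε1
    rw [le_div_iff₀ (by positivity)]
    have : ε * N ^ 4 ≤ ε * (Lconst S * N ^ 4) :=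
      mul_le_mul_of_nonneg_left (le_mul_of_one_le_left (by positivity) hL) hε0.le
    linarith [show ε * N ^ 2 * N ^ 2 = ε * N ^ 4 by ring]
  have hinv : (N ^ 2)⁻¹ ≤ 1 / 4 := by
    rw [inv_le_comm₀ (by positivity) (by norm_num)]
    linarith
  have hinv0 : 0 ≤ (N ^ 2)⁻¹ := by positivity
  rw [div_eq_mul_inv] at hεN ⊢
  have herr : N ^ 2 * (ε * zeta q μ) ≤ (1 - β) * (1 / 4) * X := by
    calc N ^ 2 * (ε * zeta q μ) = ε * N ^ 2 * zeta q μ := by ring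
      _ ≤ (1 - β) * (1 / 4) * X := by
        refine mul_le_mul (hεN.trans ?_) hζX hζ (by nlinarith)
        exact mul_le_mul (by nlinarith) hinv hinv0 (by linarith)
  obtain ⟨hlo, hhi⟩ := abs_le.mp hXY
  constructor
  · have : (1 - β) * (N ^ 2)⁻¹ * X ≤ (1 - β) * (1 / 4) * X := by gcongr
    nlinarith [mul_nonneg (sub_nonneg.2 hβ.le) hX]
  · have : (1 + β) * 4 * X ≤ (1 + β) * N ^ 2 * X := by gcongr
    nlinarith [mul_nonneg hβ0.le hX]

end PerturbedMC
end
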